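/- arXiv:1510.00430 — 3 statements merged into one kernel-verified Lean document; each statement's English description precedes it below -/
import Mathlib

section
/- Let D = D1 × D2 ⊆ ℂ × ℂ be an open polydisc, let Z be a nonvanishing holomorphic function on D1, W a nonvanishing holomorphic function on D2, and H a holomorphic function on D with H_z and H_w nonvanishing. Set a(z,w) = Z(z)W(w)H_z(z,w) and b(z,w) = Z(z)W(w)H_w(z,w), and let A = ∂_z(a_w/a), B = ∂_w(b_z/b). If A − B is nonvanishing on D, then the function ξ = (1/(A−B))·[ a·∂_z((b/a)·B) − b·∂_w((a/b)·A) ] satisfies ξ(z,w) = Z(z)·W(w)·H_{zw}(z,w) on D, where H_{zw} = ∂_w(H_z). -/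
noncomputable section

/-- Partial derivative in the first (`z`) variable. -/
def pz (F : ℂ × ℂ → ℂ) (p : ℂ × ℂ) : ℂ := fderiv ℂ F p (1, 0)

/-- Partial derivative in the second (`w`) variable. -/
def pw (F : ℂ × ℂ → ℂ) (p : ℂ × ℂ) : ℂ := fderiv ℂ F p (0, 1)

/-- A 1-form `P dz + Q dw` given by its pair of coefficient functions. -/
abbrev Form1 := (ℂ × ℂ → ℂ) × (ℂ × ℂ → ℂ)

/-- A 1-form is holomorphic on `U` if both coefficients are. -/
def HoloForm (ω : Form1) (U : Set (ℂ × ℂ)) : Prop :=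
  DifferentiableOn ℂ ω.1 U ∧ DifferentiableOn ℂ ω.2 U

/-- Wedge product of two 1-forms (coefficient of `dz ∧ dw`). -/
def wedge (ω ω' : Form1) (p : ℂ × ℂ) : ℂ := ω.1 p * ω'.2 p - ω.2 p * ω'.1 p

/-- Exterior derivative `Q_z - P_w` of `P dz + Q dw` (coefficient of `dz ∧ dw`). -/
def dForm (ω : Form1) (p : ℂ × ℂ) : ℂ := pz ω.2 p - pw ω.1 p

/-- A 1-form `P dz + Q dw` is closed on `V` if `P_w = Q_z` there. -/
def IsClosed1 (ω : Form1) (V : Set (ℂ × ℂ)) : Prop := ∀ p ∈ V, pw ω.1 p = pz ω.2 p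

/-- The differential of a function, as a 1-form. -/
def dfun (φ : ℂ × ℂ → ℂ) : Form1 := (pz φ, pw φ)

def addF (ω ω' : Form1) : Form1 := (fun p => ω.1 p + ω'.1 p, fun p => ω.2 p + ω'.2 p)
def subF (ω ω' : Form1) : Form1 := (fun p => ω.1 p - ω'.1 p, fun p => ω.2 p - ω'.2 p)
def fsmul (h : ℂ × ℂ → ℂ) (ω : Form1) : Form1 :=
  (fun p => h p * ω.1 p, fun p => h p * ω.2 p)
def csmul (c : ℂ) (ω : Form1) : Form1 := (fun p => c * ω.1 p, fun p => c * ω.2 p)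

/-- Coefficients of the symmetric product of three 1-forms. -/
def symC0 (a b c : Form1) (p : ℂ × ℂ) : ℂ := a.1 p * b.1 p * c.1 p
def symC1 (a b c : Form1) (p : ℂ × ℂ) : ℂ :=
  a.1 p * b.1 p * c.2 p + a.1 p * b.2 p * c.1 p + a.2 p * b.1 p * c.1 p
def symC2 (a b c : Form1) (p : ℂ × ℂ) : ℂ :=
  a.1 p * b.2 p * c.2 p + a.2 p * b.1 p * c.2 p + a.2 p * b.2 p * c.1 p
def symC3 (a b c : Form1) (p : ℂ × ℂ) : ℂ := a.2 p * b.2 p * c.2 p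

/-- The symmetric 3-differential `c0 dz³ + c1 dz²dw + c2 dz dw² + c3 dw³` is
non-degenerate at `x` if the binary cubic `c0 s³ + c1 s²t + c2 st² + c3 t³` is nonzero
and has three pairwise non-proportional roots in the projective line. -/
def NonDegAt (c0 c1 c2 c3 : ℂ × ℂ → ℂ) (x : ℂ × ℂ) : Prop :=
  (c0 x ≠ 0 ∨ c1 x ≠ 0 ∨ c2 x ≠ 0 ∨ c3 x ≠ 0) ∧
  ∃ r : Fin 3 → ℂ × ℂ,
    (∀ i j, i ≠ j → (r i).1 * (r j).2 - (r i).2 * (r j).1 ≠ 0) ∧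
    (∀ i, c0 x * (r i).1 ^ 3 + c1 x * (r i).1 ^ 2 * (r i).2 +
          c2 x * (r i).1 * (r i).2 ^ 2 + c3 x * (r i).2 ^ 3 = 0)

/-- A symmetric 3-differential is closed at `x` if on some open neighborhood of `x`
(inside `U`) it is a symmetric product of three closed holomorphic 1-forms. -/
def ClosedAt (U : Set (ℂ × ℂ)) (c0 c1 c2 c3 : ℂ × ℂ → ℂ) (x : ℂ × ℂ) : Prop :=
  ∃ V : Set (ℂ × ℂ), IsOpen V ∧ x ∈ V ∧ V ⊆ U ∧
    ∃ z1 z2 z3 : Form1,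
      HoloForm z1 V ∧ HoloForm z2 V ∧ HoloForm z3 V ∧
      IsClosed1 z1 V ∧ IsClosed1 z2 V ∧ IsClosed1 z3 V ∧
      ∀ p ∈ V, c0 p = symC0 z1 z2 z3 p ∧ c1 p = symC1 z1 z2 z3 p ∧
               c2 p = symC2 z1 z2 z3 p ∧ c3 p = symC3 z1 z2 z3 p

/-- `D1 × D2` is an open polydisc. -/
def IsPolydisc (D1 D2 : Set ℂ) : Prop :=
  ∃ z0 w0 : ℂ, ∃ r1 r2 : ℝ, 0 < r1 ∧ 0 < r2 ∧
    D1 = Metric.ball z0 r1 ∧ D2 = Metric.ball w0 r2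

/-- `A = ∂_z(a_w/a)`. -/
def Afun (a : ℂ × ℂ → ℂ) : ℂ × ℂ → ℂ := pz (fun p => pw a p / a p)

/-- `B = ∂_w(b_z/b)`. -/
def Bfun (b : ℂ × ℂ → ℂ) : ℂ × ℂ → ℂ := pw (fun p => pz b p / b p)

/-- `ξ = (1/(A−B))·[ a·∂_z((b/a)·B) − b·∂_w((a/b)·A) ]`. -/
def xifun (a b : ℂ × ℂ → ℂ) : ℂ × ℂ → ℂ := fun p =>
  (Afun a p - Bfun b p)⁻¹ *
    (a p * pz (fun q => b q / a q * Bfun b q) p -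
     b p * pw (fun q => a q / b q * Afun a q) p)

open Metric MeasureTheory Filter in
/-- Directional derivatives of a holomorphic function of several variables are holomorphic. -/
theorem differentiableOn_fderiv_apply_const {E : Type*} [NormedAddCommGroup E] [NormedSpace ℂ E]
    [FiniteDimensional ℂ E] {U : Set E} (hU : IsOpen U) {f : E → ℂ}
    (hf : DifferentiableOn ℂ f U) (v : E) :
    DifferentiableOn ℂ (fun x => fderiv ℂ f x v) U := by
  intro x₀ hx₀
  have hcont : ContinuousAt f x₀ := hf.continuousOn.continuousAt (hU.mem_nhds hx₀)
  obtain ⟨δ, hδ, hδU⟩ : ∃ δ > 0, ball x₀ δ ⊆ U ∩ {x | f x ∈ ball (f x₀) 1} :=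
    mem_nhds_iff.1 (inter_mem (hU.mem_nhds hx₀) (hcont (ball_mem_nhds _ one_pos)))
  have hfδ : DifferentiableOn ℂ f (ball x₀ δ) := hf.mono fun x hx => (hδU hx).1
  have hdiff : ∀ x ∈ ball x₀ δ, HasFDerivAt f (fderiv ℂ f x) x := fun x hx =>
    (hfδ.differentiableAt (isOpen_ball.mem_nhds hx)).hasFDerivAt
  have hbound : ∀ x ∈ ball x₀ (δ / 2), ‖fderiv ℂ f x‖ ≤ 2 / (δ / 2) := by
    intro x hx
    have hsub : ball x (δ / 2) ⊆ ball x₀ δ :=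
      ball_subset_ball' (by linarith [mem_ball.1 hx])
    refine Complex.norm_fderiv_le_div_of_mapsTo_ball (hfδ.mono hsub) (fun y hy => ?_)
      (by positivity)
    have h1 : dist (f y) (f x₀) < 1 := (hδU (hsub hy)).2
    have h2 : dist (f x) (f x₀) < 1 := (hδU (hsub (mem_ball_self (by positivity)))).2
    rw [mem_closedBall]
    linarith [dist_triangle_right (f y) (f x) (f x₀)]
  obtain ⟨r, hr, hrv⟩ : ∃ r > 0, r * ‖v‖ < δ / 4 := by
    refine ⟨δ / 4 / (‖v‖ + 1), by positivity, ?_⟩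
    rw [div_mul_eq_mul_div, div_lt_iff₀ (by positivity)]
    nlinarith
  have hmem : ∀ x ∈ ball x₀ (δ / 4), ∀ t ∈ closedBall (0 : ℂ) r, x + t • v ∈ ball x₀ (δ / 2) := by
    intro x hx t ht
    rw [mem_ball, dist_eq_norm] at hx ⊢
    have htr : ‖t‖ ≤ r := by simpa using ht
    calc ‖x + t • v - x₀‖ = ‖(x - x₀) + t • v‖ := by congr 1; abel
      _ ≤ ‖x - x₀‖ + ‖t‖ * ‖v‖ := (norm_add_le _ _).trans_eq (by rw [norm_smul])
      _ < δ / 2 := by linarith [mul_le_mul_of_nonneg_right htr (norm_nonneg v)]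
  have hhalf : ball x₀ (δ / 2) ⊆ ball x₀ δ := ball_subset_ball (by linarith)
  have hcircle : ∀ θ, circleMap 0 r θ ∈ closedBall (0 : ℂ) r :=
    circleMap_mem_closedBall 0 hr.le
  set k : ℝ → ℂ := fun θ => deriv (circleMap 0 r) θ * ((circleMap 0 r θ - 0) ^ 2)⁻¹ with hk
  have hkcont : Continuous k := by
    simp only [hk, deriv_circleMap]
    refine ((continuous_circleMap 0 r).mul continuous_const).mul
      (Continuous.inv₀ (by fun_prop) fun θ => ?_)
    simpa using hr.ne'
  let μ : Measure ℝ := volume.restrict (Set.Ioc 0 (2 * Real.pi))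
  have hFcont : ∀ x ∈ ball x₀ (δ / 4),
      Continuous fun θ : ℝ => k θ * f (x + circleMap 0 r θ • v) := fun x hx =>
    hkcont.mul (hfδ.continuousOn.comp_continuous (by fun_prop)
      fun θ => hhalf (hmem x hx _ (hcircle θ)))
  have hint : ∀ {g : ℝ → ℂ}, Continuous g → Integrable g μ := fun hg =>
    (hg.integrableOn_Icc).mono_set Set.Ioc_subset_Icc_self
  have hmain : HasFDerivAt (fun x => ∫ θ, k θ * f (x + circleMap 0 r θ • v) ∂μ)
      (∫ θ, k θ • fderiv ℂ f (x₀ + circleMap 0 r θ • v) ∂μ) x₀ := by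
    refine hasFDerivAt_integral_of_dominated_of_fderiv_le
      (F' := fun x θ => k θ • fderiv ℂ f (x + circleMap 0 r θ • v))
      (bound := fun θ => ‖k θ‖ * (2 / (δ / 2)))
      (ball_mem_nhds x₀ (show 0 < δ / 4 by positivity)) ?_ ?_ ?_ ?_ ?_ ?_
    · filter_upwards [ball_mem_nhds x₀ (show 0 < δ / 4 by positivity)] with x hx
      exact (hFcont x hx).aestronglyMeasurable
    · exact hint (hFcont x₀ (mem_ball_self (by positivity)))
    · borelize E
      borelize (E →L[ℂ] ℂ)
      have : CompleteSpace E := FiniteDimensional.complete ℂ E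
      have : SecondCountableTopology E := by
        have : ProperSpace E := FiniteDimensional.proper ℂ E
        infer_instance
      have hm : Measurable fun θ : ℝ => fderiv ℂ f (x₀ + circleMap 0 r θ • v) :=
        (measurable_fderiv ℂ f).comp (by fun_prop : Continuous _).measurable
      exact hkcont.aestronglyMeasurable.smul hm.aestronglyMeasurable
    · refine Eventually.of_forall fun θ x hx => ?_
      rw [norm_smul]
      gcongr
      exact hbound _ (hmem x hx _ (hcircle θ))
    · exact ((hkcont.norm.mul continuous_const).integrableOn_Icc).mono_set
        Set.Ioc_subset_Icc_self
    · refine Eventually.of_forall fun θ x hx => ?_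
      exact ((hasFDerivAt_comp_add_right _).2
        (hdiff _ (hhalf (hmem x hx _ (hcircle θ))))).const_mul (k θ)
  refine DifferentiableAt.differentiableWithinAt (DifferentiableAt.congr_of_eventuallyEq
    (hmain.differentiableAt.const_mul (2 * Real.pi * Complex.I : ℂ)⁻¹) ?_)
  filter_upwards [ball_mem_nhds x₀ (show 0 < δ / 4 by positivity)] with x hx
  have hV : IsOpen ((fun t : ℂ => x + t • v) ⁻¹' ball x₀ δ) :=
    isOpen_ball.preimage (by fun_prop)
  have hline : DifferentiableOn ℂ (fun t : ℂ => f (x + t • v))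
      ((fun t : ℂ => x + t • v) ⁻¹' ball x₀ δ) :=
    hfδ.comp (by fun_prop) fun t ht => ht
  have hder : deriv (fun t : ℂ => f (x + t • v)) 0 = fderiv ℂ f x v := by
    have hx' : HasFDerivAt f (fderiv ℂ f x) x := hdiff x (ball_subset_ball (by linarith) hx)
    exact (hx'.hasLineDerivAt v).deriv
  rw [← hder, ← Complex.cderiv_eq_deriv hV hline hr fun t ht => hhalf (hmem x hx t ht),
    Complex.cderiv, circleIntegral, intervalIntegral.integral_of_le (by positivity)]
  simp only [hk, smul_eq_mul, mul_assoc, μ]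

/-- Holomorphic functions of several variables are smooth. -/
theorem contDiffOn_of_differentiableOn_finiteDimensional {E : Type*} [NormedAddCommGroup E]
    [NormedSpace ℂ E] [FiniteDimensional ℂ E] {U : Set E} (hU : IsOpen U) {f : E → ℂ}
    (hf : DifferentiableOn ℂ f U) (n : ℕ) : ContDiffOn ℂ n f U := by
  induction n generalizing f with
  | zero => exact contDiffOn_zero.2 hf.continuousOn
  | succ n ih =>
    push_cast
    exact (contDiffOn_succ_iff_fderiv_of_isOpen hU).2 ⟨hf, by simp, contDiffOn_clm_apply.2
      fun v => ih (differentiableOn_fderiv_apply_const hU hf v)⟩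

section DirectionalDerivatives

variable {E : Type*} [NormedAddCommGroup E] [NormedSpace ℂ E] {U : Set E} {f g : E → ℂ} {x : E}

theorem fderiv_apply_congr_of_eqOn (hU : IsOpen U) (h : Set.EqOn f g U) (hx : x ∈ U) (v : E) :
    fderiv ℂ f x v = fderiv ℂ g x v := by
  rw [(h.eventuallyEq_of_mem (hU.mem_nhds hx)).fderiv_eq]

theorem fderiv_mul_apply (hf : DifferentiableAt ℂ f x) (hg : DifferentiableAt ℂ g x) (v : E) :
    fderiv ℂ (fun y => f y * g y) x v = fderiv ℂ f x v * g x + f x * fderiv ℂ g x v := by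
  simp [fderiv_fun_mul hf hg]
  ring

theorem differentiableAt_div (hf : DifferentiableAt ℂ f x) (hg : DifferentiableAt ℂ g x)
    (hx : g x ≠ 0) : DifferentiableAt ℂ (fun y => f y / g y) x := by
  simp only [div_eq_mul_inv]
  exact hf.fun_mul (hg.inv hx)

theorem fderiv_div_apply (hf : DifferentiableAt ℂ f x) (hg : DifferentiableAt ℂ g x)
    (hx : g x ≠ 0) (v : E) :
    fderiv ℂ (fun y => f y / g y) x v =
      (fderiv ℂ f x v * g x - f x * fderiv ℂ g x v) / g x ^ 2 := by
  have h := (hf.hasFDerivAt.hasLineDerivAt v).fun_div (hg.hasFDerivAt.hasLineDerivAt v)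
    (by simpa using hx)
  have h' := (differentiableAt_div hf hg hx).hasFDerivAt.hasLineDerivAt v
  simpa using h'.unique h

/-- Mixed directional derivatives of a holomorphic function of several variables commute. -/
theorem fderiv_fderiv_apply_comm [FiniteDimensional ℂ E] (hU : IsOpen U)
    (hf : DifferentiableOn ℂ f U) (hx : x ∈ U) (u v : E) :
    fderiv ℂ (fun y => fderiv ℂ f y u) x v = fderiv ℂ (fun y => fderiv ℂ f y v) x u := by
  have hd : DifferentiableAt ℂ (fderiv ℂ f) x := by
    have h2 : ContDiffOn ℂ 2 f U := contDiffOn_of_differentiableOn_finiteDimensional hU hf 2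
    exact ((contDiffOn_succ_iff_fderiv_of_isOpen (n := 1) hU).1 h2).2.2.differentiableOn
      one_ne_zero |>.differentiableAt (hU.mem_nhds hx)
  have hsymm := second_derivative_symmetric_of_eventually
    (by filter_upwards [hU.mem_nhds hx] with y hy
        exact (hf.differentiableAt (hU.mem_nhds hy)).hasFDerivAt) hd.hasFDerivAt u v
  simpa [fderiv_clm_apply hd (differentiableAt_const _)] using hsymm.symm

variable [FiniteDimensional ℂ E] {c : E → ℂ} {u v : E}

/-- If `∂ᵤ (∂ᵥ c / c) = 0`, then the factor `c` does not contribute to `∂ᵤ (∂ᵥ a / a)` for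
`a = c * P`. -/
theorem fderiv_logDeriv_mul_apply {P : E → ℂ} (hU : IsOpen U) (hc : DifferentiableOn ℂ c U)
    (hc0 : ∀ y ∈ U, c y ≠ 0) (hP : DifferentiableOn ℂ P U) (hP0 : ∀ y ∈ U, P y ≠ 0)
    (hcuv : ∀ y ∈ U, fderiv ℂ (fun q => fderiv ℂ c q v / c q) y u = 0) (hx : x ∈ U) :
    fderiv ℂ (fun q => fderiv ℂ (fun y => c y * P y) q v / (c q * P q)) x u =
      (fderiv ℂ (fun y => fderiv ℂ P y v) x u * P x - fderiv ℂ P x v * fderiv ℂ P x u) /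
        P x ^ 2 := by
  have hat {F : E → ℂ} (hF : DifferentiableOn ℂ F U) {y : E} (hy : y ∈ U) :
      DifferentiableAt ℂ F y := hF.differentiableAt (hU.mem_nhds hy)
  have hcv := differentiableOn_fderiv_apply_const hU hc v
  have hPv := differentiableOn_fderiv_apply_const hU hP v
  have hEq : Set.EqOn (fun q => fderiv ℂ (fun y => c y * P y) q v / (c q * P q))
      (fun q => fderiv ℂ c q v / c q + fderiv ℂ P q v / P q) U := by
    intro q hq
    have := hc0 q hq
    have := hP0 q hq
    simp only [fderiv_mul_apply (hat hc hq) (hat hP hq)]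
    field_simp
  rw [fderiv_apply_congr_of_eqOn hU hEq hx,
    fderiv_fun_add (differentiableAt_div (hat hcv hx) (hat hc hx) (hc0 x hx))
      (differentiableAt_div (hat hPv hx) (hat hP hx) (hP0 x hx)),
    add_apply, hcuv x hx, zero_add,
    fderiv_div_apply (hat hPv hx) (hat hP hx) (hP0 x hx)]

/-- Expansion of `a ∂ᵤ((b / a) B)` for `a = c P`, `b = c Q`, where `R = ∂ᵤ Q` and
`B = ∂ᵥ(R / Q)`. -/
theorem mul_fderiv_div_mul_apply {P Q R B : E → ℂ} (hU : IsOpen U)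
    (hc0 : ∀ y ∈ U, c y ≠ 0)
    (hP : DifferentiableOn ℂ P U) (hQ : DifferentiableOn ℂ Q U) (hR : DifferentiableOn ℂ R U)
    (hP0 : ∀ y ∈ U, P y ≠ 0) (hQ0 : ∀ y ∈ U, Q y ≠ 0)
    (hQR : ∀ y ∈ U, fderiv ℂ Q y u = R y)
    (hB : ∀ y ∈ U, B y = (fderiv ℂ R y v * Q y - R y * fderiv ℂ Q y v) / Q y ^ 2)
    (hx : x ∈ U) :
    c x * P x * fderiv ℂ (fun q => c q * Q q / (c q * P q) * B q) x u =
      c x * (fderiv ℂ (fun y => fderiv ℂ R y v) x u - fderiv ℂ R x v * fderiv ℂ P x u / P x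
        - fderiv ℂ R x u * fderiv ℂ Q x v / Q x - R x * fderiv ℂ R x v / Q x
        + R x * fderiv ℂ Q x v * fderiv ℂ P x u / (P x * Q x)
        + R x ^ 2 * fderiv ℂ Q x v / Q x ^ 2) := by
  have hat {F : E → ℂ} (hF : DifferentiableOn ℂ F U) {y : E} (hy : y ∈ U) :
      DifferentiableAt ℂ F y := hF.differentiableAt (hU.mem_nhds hy)
  have hRv := differentiableOn_fderiv_apply_const hU hR v
  have hQv := differentiableOn_fderiv_apply_const hU hQ v
  have hEq : Set.EqOn (fun q => c q * Q q / (c q * P q) * B q)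
      (fun q => (fderiv ℂ R q v * Q q - R q * fderiv ℂ Q q v) / (P q * Q q)) U := by
    intro q hq
    have := hc0 q hq
    have := hP0 q hq
    have := hQ0 q hq
    simp only [hB q hq]
    field_simp
  have hQuv : fderiv ℂ (fun y => fderiv ℂ Q y v) x u = fderiv ℂ R x v := by
    rw [fderiv_fderiv_apply_comm hU hQ hx]
    exact fderiv_apply_congr_of_eqOn hU hQR hx v
  have hPx := hP0 x hx
  have hQx := hQ0 x hx
  rw [fderiv_apply_congr_of_eqOn hU hEq hx,
    fderiv_div_apply (((hat hRv hx).fun_mul (hat hQ hx)).fun_sub ((hat hR hx).fun_mul (hat hQv hx)))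
      ((hat hP hx).fun_mul (hat hQ hx)) (mul_ne_zero hPx hQx),
    fderiv_fun_sub ((hat hRv hx).fun_mul (hat hQ hx)) ((hat hR hx).fun_mul (hat hQv hx)),
    sub_apply, fderiv_mul_apply (hat hRv hx) (hat hQ hx),
    fderiv_mul_apply (hat hR hx) (hat hQv hx), fderiv_mul_apply (hat hP hx) (hat hQ hx),
    hQuv, hQR x hx]
  field_simp
  ring

end DirectionalDerivatives

/-- The logarithmic derivative of `Z(z) W(w)` in one variable does not depend on the other one. -/
theorem pz_pw_div_separated {D1 D2 : Set ℂ} (hD1 : IsOpen D1) (hD2 : IsOpen D2) {Z W : ℂ → ℂ}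
    (hZ : DifferentiableOn ℂ Z D1) (hZ0 : ∀ z ∈ D1, Z z ≠ 0)
    (hW : DifferentiableOn ℂ W D2) (hW0 : ∀ w ∈ D2, W w ≠ 0) {p : ℂ × ℂ} (hp : p ∈ D1 ×ˢ D2) :
    pz (fun q => pw (fun y => Z y.1 * W y.2) q / (Z q.1 * W q.2)) p = 0 ∧
    pw (fun q => pz (fun y => Z y.1 * W y.2) q / (Z q.1 * W q.2)) p = 0 := by
  have hZ' (z : ℂ) (hz : z ∈ D1) := hZ.differentiableAt (hD1.mem_nhds hz)
  have hW' (w : ℂ) (hw : w ∈ D2) := hW.differentiableAt (hD2.mem_nhds hw)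
  have hfst {q : ℂ × ℂ} {G : ℂ → ℂ} (hG : DifferentiableAt ℂ G q.1) :
      HasFDerivAt (fun y : ℂ × ℂ => G y.1)
        (deriv G q.1 • ContinuousLinearMap.fst ℂ ℂ ℂ) q :=
    hG.hasDerivAt.comp_hasFDerivAt q hasFDerivAt_fst
  have hsnd {q : ℂ × ℂ} {G : ℂ → ℂ} (hG : DifferentiableAt ℂ G q.2) :
      HasFDerivAt (fun y : ℂ × ℂ => G y.2)
        (deriv G q.2 • ContinuousLinearMap.snd ℂ ℂ ℂ) q :=
    hG.hasDerivAt.comp_hasFDerivAt q hasFDerivAt_snd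
  have hU := hD1.prod hD2
  constructor
  · have hEq : Set.EqOn (fun q : ℂ × ℂ => pw (fun y => Z y.1 * W y.2) q / (Z q.1 * W q.2))
        (fun q => deriv W q.2 / W q.2) (D1 ×ˢ D2) := by
      intro q hq
      have := hZ0 _ hq.1
      have := hW0 _ hq.2
      simp only [pw, ((hfst (hZ' _ hq.1)).fun_mul (hsnd (hW' _ hq.2))).fderiv]
      simp
      field_simp
    rw [pz, fderiv_apply_congr_of_eqOn hU hEq hp,
      (hsnd (G := fun w => deriv W w / W w) (((hW.deriv hD2).differentiableAt
        (hD2.mem_nhds hp.2)).fun_div (hW' _ hp.2) (hW0 _ hp.2))).fderiv]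
    simp
  · have hEq : Set.EqOn (fun q : ℂ × ℂ => pz (fun y => Z y.1 * W y.2) q / (Z q.1 * W q.2))
        (fun q => deriv Z q.1 / Z q.1) (D1 ×ˢ D2) := by
      intro q hq
      have := hZ0 _ hq.1
      have := hW0 _ hq.2
      simp only [pz, ((hfst (hZ' _ hq.1)).fun_mul (hsnd (hW' _ hq.2))).fderiv]
      simp
      field_simp
    rw [pw, fderiv_apply_congr_of_eqOn hU hEq hp,
      (hfst (G := fun z => deriv Z z / Z z) (((hZ.deriv hD1).differentiableAt
        (hD1.mem_nhds hp.1)).fun_div (hZ' _ hp.1) (hZ0 _ hp.1))).fderiv]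
    simp

/-- if `a = Z(z)W(w)H_z` and `b = Z(z)W(w)H_w` on a polydisc, with
`A − B` nonvanishing, then `ξ = Z(z)W(w)H_{zw}`. -/
theorem stmt_5 (D1 D2 : Set ℂ) (hD : IsPolydisc D1 D2)
    (Z W : ℂ → ℂ) (H : ℂ × ℂ → ℂ)
    (hZ : DifferentiableOn ℂ Z D1) (hZ0 : ∀ z ∈ D1, Z z ≠ 0)
    (hW : DifferentiableOn ℂ W D2) (hW0 : ∀ w ∈ D2, W w ≠ 0)
    (hH : DifferentiableOn ℂ H (D1 ×ˢ D2))
    (hHz : ∀ p ∈ D1 ×ˢ D2, pz H p ≠ 0) (hHw : ∀ p ∈ D1 ×ˢ D2, pw H p ≠ 0)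
    (a b : ℂ × ℂ → ℂ)
    (hadef : a = fun p => Z p.1 * W p.2 * pz H p)
    (hbdef : b = fun p => Z p.1 * W p.2 * pw H p)
    (hAB : ∀ p ∈ D1 ×ˢ D2, Afun a p - Bfun b p ≠ 0) :
    ∀ p ∈ D1 ×ˢ D2, xifun a b p = Z p.1 * W p.2 * pw (fun q => pz H q) p := by
  obtain ⟨z0, w0, r1, r2, -, -, rfl, rfl⟩ := hD
  set D := Metric.ball z0 r1 ×ˢ Metric.ball w0 r2
  have hU : IsOpen D := Metric.isOpen_ball.prod Metric.isOpen_ball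
  have hc : DifferentiableOn ℂ (fun q : ℂ × ℂ => Z q.1 * W q.2) D :=
    (hZ.comp differentiableOn_fst fun _ hq => hq.1).mul
      (hW.comp differentiableOn_snd fun _ hq => hq.2)
  have hc0 : ∀ q ∈ D, Z q.1 * W q.2 ≠ 0 := fun q hq => mul_ne_zero (hZ0 _ hq.1) (hW0 _ hq.2)
  have hP : DifferentiableOn ℂ (pz H) D := differentiableOn_fderiv_apply_const hU hH _
  have hQ : DifferentiableOn ℂ (pw H) D := differentiableOn_fderiv_apply_const hU hH _
  have hR : DifferentiableOn ℂ (pw (pz H)) D := differentiableOn_fderiv_apply_const hU hP _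
  have hQR : ∀ q ∈ D, pz (pw H) q = pw (pz H) q := fun q hq =>
    fderiv_fderiv_apply_comm hU hH hq _ _
  have hsep (q : ℂ × ℂ) (hq : q ∈ D) :=
    pz_pw_div_separated Metric.isOpen_ball Metric.isOpen_ball hZ hZ0 hW hW0 hq
  have hA : ∀ q ∈ D, Afun a q =
      (pz (pw (pz H)) q * pz H q - pw (pz H) q * pz (pz H) q) / pz H q ^ 2 := by
    intro q hq
    rw [hadef]
    exact fderiv_logDeriv_mul_apply hU hc hc0 hP hHz (fun y hy => (hsep y hy).1) hq
  have hB : ∀ q ∈ D, Bfun b q =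
      (pw (pw (pz H)) q * pw H q - pw (pz H) q * pw (pw H) q) / pw H q ^ 2 := by
    intro q hq
    have h : Bfun b q = (pw (pz (pw H)) q * pw H q - pz (pw H) q * pw (pw H) q) / pw H q ^ 2 := by
      rw [hbdef]
      exact fderiv_logDeriv_mul_apply hU hc hc0 hQ hHw (fun y hy => (hsep y hy).2) hq
    rw [h, hQR q hq, show pw (pz (pw H)) q = pw (pw (pz H)) q from
      fderiv_apply_congr_of_eqOn hU hQR hq _]
  intro p hp
  have hRcomm : pw (pz (pw (pz H))) p = pz (pw (pw (pz H))) p :=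
    fderiv_fderiv_apply_comm hU hR hp _ _
  have h1 : a p * pz (fun q => b q / a q * Bfun b q) p = Z p.1 * W p.2 *
      (pz (pw (pw (pz H))) p - pw (pw (pz H)) p * pz (pz H) p / pz H p
        - pz (pw (pz H)) p * pw (pw H) p / pw H p - pw (pz H) p * pw (pw (pz H)) p / pw H p
        + pw (pz H) p * pw (pw H) p * pz (pz H) p / (pz H p * pw H p)
        + pw (pz H) p ^ 2 * pw (pw H) p / pw H p ^ 2) := by
    have := mul_fderiv_div_mul_apply hU hc0 hP hQ hR hHz hHw hQR hB hp
    rwa [hadef, hbdef] at *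
  have h2 : b p * pw (fun q => a q / b q * Afun a q) p = Z p.1 * W p.2 *
      (pw (pz (pw (pz H))) p - pz (pw (pz H)) p * pw (pw H) p / pw H p
        - pw (pw (pz H)) p * pz (pz H) p / pz H p - pw (pz H) p * pz (pw (pz H)) p / pz H p
        + pw (pz H) p * pz (pz H) p * pw (pw H) p / (pw H p * pz H p)
        + pw (pz H) p ^ 2 * pz (pz H) p / pz H p ^ 2) := by
    have := mul_fderiv_div_mul_apply hU hc0 hQ hP hR hHw hHz (fun _ _ => rfl) hA hp
    rwa [hadef, hbdef] at *
  have hPx := hHz p hp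
  have hQx := hHw p hp
  rw [xifun, inv_mul_eq_iff_eq_mul₀ (hAB p hp), h1, h2, hA p hp, hB p hp, hRcomm]
  field_simp
  ring
end
end

section
/- Let D = D1 × D2 ⊆ ℂ × ℂ be an open polydisc, let a, b be nonvanishing holomorphic functions on D, set A = ∂_z(a_w/a), B = ∂_w(b_z/b), assume A − B is nonvanishing on D, and define ξ = (1/(A−B))·[ a·∂_z((b/a)·B) − b·∂_w((a/b)·A) ]. If ∂_z(ξ/a) = A and ∂_w(ξ/b) = B on D, then there exist a nonvanishing holomorphic function Z on D1, a nonvanishing holomorphic function W on D2, and a holomorphic function H on D such that a(z,w) = Z(z)W(w)H_z(z,w) and b(z,w) = Z(z)W(w)H_w(z,w) on D. -/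
noncomputable section

open MeasureTheory in
/-- Directional derivatives of a holomorphic function of several variables are holomorphic. -/
theorem differentiableOn_fderiv_apply {E : Type*} [NormedAddCommGroup E]
    [NormedSpace ℂ E] [FiniteDimensional ℂ E] {F : E → ℂ} {U : Set E}
    (hF : DifferentiableOn ℂ F U) (hU : IsOpen U) (v : E) :
    DifferentiableOn ℂ (fun p => fderiv ℂ F p v) U := by
  intro p₀ hp₀
  have hc : ContinuousAt F p₀ := (hF.differentiableAt (hU.mem_nhds hp₀)).continuousAt
  obtain ⟨ρ, hρ, hball⟩ := Metric.mem_nhds_iff.1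
    (Filter.inter_mem (hU.mem_nhds hp₀) (hc.preimage_mem_nhds (Metric.ball_mem_nhds _ one_pos)))
  have hd : ∀ q ∈ Metric.ball p₀ ρ, DifferentiableAt ℂ F q := fun q hq =>
    hF.differentiableAt (hU.mem_nhds (hball hq).1)
  have hbound : ∀ q ∈ Metric.ball p₀ (ρ / 2), ‖fderiv ℂ F q‖ ≤ 2 / (ρ / 2) := by
    intro q hq
    have hsub : Metric.ball q (ρ / 2) ⊆ Metric.ball p₀ ρ :=
      Metric.ball_subset_ball' (by rw [Metric.mem_ball] at hq; linarith)
    refine Complex.norm_fderiv_le_div_of_mapsTo_ball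
      (fun x hx => (hd x (hsub hx)).differentiableWithinAt) (fun x hx => ?_) (by positivity)
    have h1 : dist (F x) (F p₀) < 1 := (hball (hsub hx)).2
    have h2 : dist (F q) (F p₀) < 1 := (hball (hsub (Metric.mem_ball_self (by positivity)))).2
    rw [Metric.mem_closedBall]
    linarith [dist_triangle_right (F x) (F q) (F p₀)]
  set r : ℝ := ρ / (4 * (‖v‖ + 1)) with hr
  have hr0 : 0 < r := by positivity
  have hrv : r * ‖v‖ ≤ ρ / 4 := by
    rw [hr, div_mul_eq_mul_div, div_le_div_iff₀ (by positivity) (by positivity)]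
    nlinarith [norm_nonneg v]
  have hmem : ∀ p ∈ Metric.ball p₀ (ρ / 4), ∀ ζ : ℂ, ‖ζ‖ ≤ r →
      p + ζ • v ∈ Metric.ball p₀ (ρ / 2) := by
    intro p hp ζ hζ
    rw [mem_ball_iff_norm] at hp ⊢
    calc ‖p + ζ • v - p₀‖ = ‖(p - p₀) + ζ • v‖ := by congr 1; abel
      _ ≤ ‖p - p₀‖ + ‖ζ‖ * ‖v‖ := (norm_add_le _ _).trans (by rw [norm_smul])
      _ < ρ / 2 := by nlinarith [norm_nonneg v]
  have hcirc : ∀ θ : ℝ, ‖circleMap 0 r θ‖ ≤ r := fun θ => by simp [abs_of_pos hr0]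
  have hhalf : Metric.ball p₀ (ρ / 2) ⊆ Metric.ball p₀ ρ :=
    Metric.ball_subset_ball (by linarith)
  set k : ℝ → ℂ := fun θ => deriv (circleMap 0 r) θ * ((circleMap 0 r θ - 0) ^ 2)⁻¹ with hk
  have hkc : Continuous k := by
    have : ∀ θ, (circleMap 0 r θ - 0) ^ 2 ≠ 0 := fun θ => by simp [hr0.ne']
    simp only [hk, deriv_circleMap]
    exact ((continuous_circleMap 0 r).mul continuous_const).mul
      ((((continuous_circleMap 0 r).sub continuous_const).pow 2).inv₀ this)
  have hlin : ∀ p, Continuous fun θ : ℝ => p + circleMap 0 r θ • v := fun p =>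
    continuous_const.add ((continuous_circleMap 0 r).smul continuous_const)
  have hcauchy : ∀ p ∈ Metric.ball p₀ (ρ / 4), fderiv ℂ F p v =
      (2 * Real.pi * Complex.I : ℂ)⁻¹ •
        ∫ θ in Set.Ioc 0 (2 * Real.pi), k θ * F (p + circleMap 0 r θ • v) := by
    intro p hp
    have hline : ∀ ζ : ℂ, HasDerivAt (fun ζ : ℂ => p + ζ • v) v ζ := fun ζ => by
      simpa using ((hasDerivAt_id ζ).smul_const v).const_add p
    have hderiv : deriv (fun ζ : ℂ => F (p + ζ • v)) 0 = fderiv ℂ F p v := by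
      have h0 : DifferentiableAt ℂ F (p + (0 : ℂ) • v) :=
        hd _ (hhalf (hmem p hp 0 (by simpa using hr0.le)))
      have := (h0.hasFDerivAt.comp_hasDerivAt (0 : ℂ) (hline 0)).deriv
      simpa [Function.comp_def] using this
    have hopen : IsOpen ((fun ζ : ℂ => p + ζ • v) ⁻¹' Metric.ball p₀ ρ) :=
      Metric.isOpen_ball.preimage (by fun_prop)
    rw [← hderiv, ← Complex.two_pi_I_inv_smul_circleIntegral_sub_sq_inv_smul_of_differentiable
      hopen (c := 0) (R := r) (f := fun ζ => F (p + ζ • v)) (fun ζ hζ => hhalf (hmem p hp ζ (by simpa using hζ)))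
      (fun ζ hζ => ((hd _ hζ).comp ζ (hline ζ).differentiableAt).differentiableWithinAt)
      (Metric.mem_ball_self hr0), circleIntegral,
      intervalIntegral.integral_of_le (by positivity)]
    simp only [hk, smul_eq_mul, mul_assoc]
  have hcontF : ∀ p ∈ Metric.ball p₀ (ρ / 4),
      Continuous fun θ : ℝ => k θ * F (p + circleMap 0 r θ • v) := by
    intro p hp
    refine hkc.mul (continuous_iff_continuousAt.2 fun θ => ?_)
    exact ContinuousAt.comp (f := fun θ : ℝ => p + circleMap 0 r θ • v)
      (hd _ (hhalf (hmem p hp _ (hcirc θ)))).continuousAt (hlin p).continuousAt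
  have hnhds : Metric.ball p₀ (ρ / 4) ∈ nhds p₀ := Metric.ball_mem_nhds _ (by positivity)
  have hp₀' : p₀ ∈ Metric.ball p₀ (ρ / 4) := mem_of_mem_nhds hnhds
  borelize E
  have : ProperSpace (E →L[ℂ] ℂ) := FiniteDimensional.proper ℂ _
  have hint := hasFDerivAt_integral_of_dominated_of_fderiv_le (𝕜 := ℂ)
    (μ := volume.restrict (Set.Ioc 0 (2 * Real.pi)))
    (F := fun p θ => k θ * F (p + circleMap 0 r θ • v))
    (F' := fun p θ => k θ • fderiv ℂ F (p + circleMap 0 r θ • v))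
    (bound := fun θ => ‖k θ‖ * (2 / (ρ / 2))) hnhds
    (Filter.eventually_of_mem hnhds fun p hp => (hcontF p hp).aestronglyMeasurable)
    ((hcontF p₀ hp₀').integrableOn_Ioc)
    (hkc.aestronglyMeasurable.smul
      ((measurable_fderiv ℂ F).comp (hlin p₀).measurable).aestronglyMeasurable)
    (Filter.Eventually.of_forall fun θ p hp => by
      rw [norm_smul]
      exact mul_le_mul_of_nonneg_left (hbound _ (hmem p hp _ (hcirc θ))) (norm_nonneg _))
    ((hkc.norm.mul continuous_const).integrableOn_Ioc)
    (Filter.Eventually.of_forall fun θ p hp =>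
      (((hasFDerivAt_comp_add_right (circleMap 0 r θ • v)).2
        (hd _ (hhalf (hmem p hp _ (hcirc θ)))).hasFDerivAt)).const_mul (k θ))
  exact ((hint.differentiableAt.const_smul (2 * Real.pi * Complex.I : ℂ)⁻¹).congr_of_eventuallyEq
    (Filter.eventually_of_mem hnhds hcauchy)).differentiableWithinAt

theorem DifferentiableOn.pz {F : ℂ × ℂ → ℂ} {U : Set (ℂ × ℂ)}
    (hF : DifferentiableOn ℂ F U) (hU : IsOpen U) : DifferentiableOn ℂ (pz F) U :=
  differentiableOn_fderiv_apply hF hU _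

theorem DifferentiableOn.pw {F : ℂ × ℂ → ℂ} {U : Set (ℂ × ℂ)}
    (hF : DifferentiableOn ℂ F U) (hU : IsOpen U) : DifferentiableOn ℂ (pw F) U :=
  differentiableOn_fderiv_apply hF hU _

theorem hasDerivAt_slice_fst {F : ℂ × ℂ → ℂ} {p : ℂ × ℂ} (hF : DifferentiableAt ℂ F p) :
    HasDerivAt (fun z => F (z, p.2)) (pz F p) p.1 :=
  HasFDerivAt.comp_hasDerivAt (f := fun z : ℂ => (z, p.2)) p.1 hF.hasFDerivAt
    ((hasDerivAt_id p.1).prodMk (hasDerivAt_const p.1 p.2))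

theorem hasDerivAt_slice_snd {F : ℂ × ℂ → ℂ} {p : ℂ × ℂ} (hF : DifferentiableAt ℂ F p) :
    HasDerivAt (fun w => F (p.1, w)) (pw F p) p.2 :=
  HasFDerivAt.comp_hasDerivAt (f := fun w : ℂ => (p.1, w)) p.2 hF.hasFDerivAt
    ((hasDerivAt_const p.2 p.1).prodMk (hasDerivAt_id p.2))

theorem eq_of_pz_eq_zero {F : ℂ × ℂ → ℂ} {D₁ D₂ : Set ℂ} (h₁ : IsOpen D₁)
    (h₁' : IsPreconnected D₁) (hF : ∀ p ∈ D₁ ×ˢ D₂, DifferentiableAt ℂ F p)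
    (h0 : ∀ p ∈ D₁ ×ˢ D₂, pz F p = 0) {z z' w : ℂ} (hz : z ∈ D₁) (hz' : z' ∈ D₁)
    (hw : w ∈ D₂) : F (z, w) = F (z', w) := by
  have hslice : ∀ x ∈ D₁, HasDerivAt (fun z => F (z, w)) 0 x := fun x hx =>
    h0 (x, w) ⟨hx, hw⟩ ▸ hasDerivAt_slice_fst (hF (x, w) ⟨hx, hw⟩)
  exact h₁.is_const_of_deriv_eq_zero h₁'
    (fun x hx => (hslice x hx).differentiableAt.differentiableWithinAt)
    (fun x hx => (hslice x hx).deriv) hz hz'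

theorem eq_of_pw_eq_zero {F : ℂ × ℂ → ℂ} {D₁ D₂ : Set ℂ} (h₂ : IsOpen D₂)
    (h₂' : IsPreconnected D₂) (hF : ∀ p ∈ D₁ ×ˢ D₂, DifferentiableAt ℂ F p)
    (h0 : ∀ p ∈ D₁ ×ˢ D₂, pw F p = 0) {z w w' : ℂ} (hz : z ∈ D₁) (hw : w ∈ D₂)
    (hw' : w' ∈ D₂) : F (z, w) = F (z, w') := by
  have hslice : ∀ x ∈ D₂, HasDerivAt (fun w => F (z, w)) 0 x := fun x hx =>
    h0 (z, x) ⟨hz, hx⟩ ▸ hasDerivAt_slice_snd (hF (z, x) ⟨hz, hx⟩)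
  exact h₂.is_const_of_deriv_eq_zero h₂'
    (fun x hx => (hslice x hx).differentiableAt.differentiableWithinAt)
    (fun x hx => (hslice x hx).deriv) hw hw'

theorem fderiv_apply_eq_pz_pw (F : ℂ × ℂ → ℂ) (p x : ℂ × ℂ) :
    fderiv ℂ F p x = x.1 * pz F p + x.2 * pw F p := by
  have hx : x = x.1 • ((1, 0) : ℂ × ℂ) + x.2 • ((0, 1) : ℂ × ℂ) := by ext <;> simp
  conv_lhs => rw [hx, map_add, map_smul, map_smul]
  rfl

/-- A closed holomorphic 1-form on a convex open set has a holomorphic primitive. -/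
theorem IsClosed1.exists_primitive {ω : Form1} {U : Set (ℂ × ℂ)} (hω : IsClosed1 ω U)
    (hd : HoloForm ω U) (hU : IsOpen U) (hc : Convex ℝ U) :
    ∃ H : ℂ × ℂ → ℂ, DifferentiableOn ℂ H U ∧ ∀ p ∈ U, pz H p = ω.1 p ∧ pw H p = ω.2 p := by
  obtain ⟨H, hH⟩ := hc.exists_forall_hasFDerivWithinAt_of_hasFDerivWithinAt_symmetric
    (ω := fun p => ω.1 p • ContinuousLinearMap.fst ℂ ℂ ℂ + ω.2 p • ContinuousLinearMap.snd ℂ ℂ ℂ)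
    (fun p hp => (((hd.1.differentiableAt (hU.mem_nhds hp)).hasFDerivAt.smul_const _).add
      ((hd.2.differentiableAt (hU.mem_nhds hp)).hasFDerivAt.smul_const
        _)).hasFDerivWithinAt.restrictScalars ℝ)
    (by
      intro p hp x _ y _
      simp [fderiv_apply_eq_pz_pw, hω p hp]
      ring)
  have hH' : ∀ p ∈ U, HasFDerivAt H (ω.1 p • ContinuousLinearMap.fst ℂ ℂ ℂ +
      ω.2 p • ContinuousLinearMap.snd ℂ ℂ ℂ) p := fun p hp =>
    (hH p hp).hasFDerivAt (hU.mem_nhds hp)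
  refine ⟨H, fun p hp => (hH' p hp).differentiableAt.differentiableWithinAt, fun p hp => ?_⟩
  simp [pz, pw, (hH' p hp).fderiv]

theorem differentiableOn_div {E : Type*} [NormedAddCommGroup E] [NormedSpace ℂ E]
    {F G : E → ℂ} {U : Set E} (hF : DifferentiableOn ℂ F U) (hG : DifferentiableOn ℂ G U)
    (hG0 : ∀ p ∈ U, G p ≠ 0) : DifferentiableOn ℂ (fun p => F p / G p) U := by
  simpa only [div_eq_mul_inv] using hF.fun_mul (hG.fun_inv hG0)

theorem differentiableOn_xifun {a b : ℂ × ℂ → ℂ} {U : Set (ℂ × ℂ)} (hU : IsOpen U)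
    (ha : DifferentiableOn ℂ a U) (hb : DifferentiableOn ℂ b U)
    (ha0 : ∀ p ∈ U, a p ≠ 0) (hb0 : ∀ p ∈ U, b p ≠ 0)
    (hAB : ∀ p ∈ U, Afun a p - Bfun b p ≠ 0) : DifferentiableOn ℂ (xifun a b) U := by
  have hA : DifferentiableOn ℂ (Afun a) U := (differentiableOn_div (ha.pw hU) ha ha0).pz hU
  have hB : DifferentiableOn ℂ (Bfun b) U := (differentiableOn_div (hb.pz hU) hb hb0).pw hU
  exact ((hA.fun_sub hB).fun_inv hAB).fun_mul
    ((ha.fun_mul (((differentiableOn_div hb ha ha0).fun_mul hB).pz hU)).fun_sub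
      (hb.fun_mul (((differentiableOn_div ha hb hb0).fun_mul hA).pw hU)))

/-- conversely, if `∂_z(ξ/a) = A` and `∂_w(ξ/b) = B` hold on a polydisc,
then `a = Z(z)W(w)H_z` and `b = Z(z)W(w)H_w` for suitable `Z`, `W`, `H`. -/
theorem stmt_7 (D1 D2 : Set ℂ) (hD : IsPolydisc D1 D2)
    (a b : ℂ × ℂ → ℂ)
    (ha : DifferentiableOn ℂ a (D1 ×ˢ D2)) (hb : DifferentiableOn ℂ b (D1 ×ˢ D2))
    (ha0 : ∀ p ∈ D1 ×ˢ D2, a p ≠ 0) (hb0 : ∀ p ∈ D1 ×ˢ D2, b p ≠ 0)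
    (hAB : ∀ p ∈ D1 ×ˢ D2, Afun a p - Bfun b p ≠ 0)
    (heq1 : ∀ p ∈ D1 ×ˢ D2, pz (fun q => xifun a b q / a q) p = Afun a p)
    (heq2 : ∀ p ∈ D1 ×ˢ D2, pw (fun q => xifun a b q / b q) p = Bfun b p) :
    ∃ Z W : ℂ → ℂ, ∃ H : ℂ × ℂ → ℂ,
      DifferentiableOn ℂ Z D1 ∧ (∀ z ∈ D1, Z z ≠ 0) ∧
      DifferentiableOn ℂ W D2 ∧ (∀ w ∈ D2, W w ≠ 0) ∧
      DifferentiableOn ℂ H (D1 ×ˢ D2) ∧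
      ∀ p ∈ D1 ×ˢ D2, a p = Z p.1 * W p.2 * pz H p ∧
                      b p = Z p.1 * W p.2 * pw H p := by
  obtain ⟨z₀, w₀, r₁, r₂, hr₁, hr₂, rfl, rfl⟩ := hD
  set D₁ := Metric.ball z₀ r₁
  set D₂ := Metric.ball w₀ r₂
  have h₁ : IsOpen D₁ := Metric.isOpen_ball
  have h₂ : IsOpen D₂ := Metric.isOpen_ball
  have hc₁ : Convex ℝ D₁ := convex_ball _ _
  have hc₂ : Convex ℝ D₂ := convex_ball _ _
  have hz₀ : z₀ ∈ D₁ := Metric.mem_ball_self hr₁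
  have hw₀ : w₀ ∈ D₂ := Metric.mem_ball_self hr₂
  have hU : IsOpen (D₁ ×ˢ D₂) := h₁.prod h₂
  have hat : ∀ {F : ℂ × ℂ → ℂ}, DifferentiableOn ℂ F (D₁ ×ˢ D₂) →
      ∀ p ∈ D₁ ×ˢ D₂, DifferentiableAt ℂ F p := fun hF p hp => hF.differentiableAt (hU.mem_nhds hp)
  have hξ := differentiableOn_xifun hU ha hb ha0 hb0 hAB
  set ξ := xifun a b
  have hξa := differentiableOn_div hξ ha ha0
  have hξb := differentiableOn_div hξ hb hb0
  have haw := differentiableOn_div (ha.pw hU) ha ha0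
  have hbz := differentiableOn_div (hb.pz hU) hb hb0
  set G : ℂ × ℂ → ℂ := fun p => pw a p / a p - ξ p / a p with hG
  set K : ℂ × ℂ → ℂ := fun p => pz b p / b p - ξ p / b p with hK
  have hGd : DifferentiableOn ℂ G (D₁ ×ˢ D₂) := haw.fun_sub hξa
  have hKd : DifferentiableOn ℂ K (D₁ ×ˢ D₂) := hbz.fun_sub hξb
  have hG0 : ∀ p ∈ D₁ ×ˢ D₂, pz G p = 0 := by
    intro p hp
    have h := heq1 p hp
    unfold Afun at h
    unfold pz at h ⊢
    rw [hG, fderiv_fun_sub (hat haw p hp) (hat hξa p hp), sub_apply, h,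
      sub_self]
  have hK0 : ∀ p ∈ D₁ ×ˢ D₂, pw K p = 0 := by
    intro p hp
    have h := heq2 p hp
    unfold Bfun at h
    unfold pw at h ⊢
    rw [hK, fderiv_fun_sub (hat hbz p hp) (hat hξb p hp), sub_apply, h,
      sub_self]
  obtain ⟨ψ, hψ⟩ := DifferentiableOn.isExactOn_ball (c := w₀) (r := r₂)
    (f := fun w => G (z₀, w)) fun w hw =>
      (hasDerivAt_slice_snd (hat hGd (z₀, w) ⟨hz₀, hw⟩)).differentiableAt.differentiableWithinAt
  obtain ⟨φ, hφ⟩ := DifferentiableOn.isExactOn_ball (c := z₀) (r := r₁)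
    (f := fun z => K (z, w₀)) fun z hz =>
      (hasDerivAt_slice_fst (hat hKd (z, w₀) ⟨hz, hw₀⟩)).differentiableAt.differentiableWithinAt
  set Φ : ℂ × ℂ → ℂ := fun p => Complex.exp (-(φ p.1 + ψ p.2))
  have hΦ : ∀ p ∈ D₁ ×ˢ D₂, HasFDerivAt Φ (Φ p • -(K p • ContinuousLinearMap.fst ℂ ℂ ℂ +
      G p • ContinuousLinearMap.snd ℂ ℂ ℂ)) p := by
    intro p hp
    have hGp : G p = G (z₀, p.2) :=
      eq_of_pz_eq_zero h₁ hc₁.isPreconnected (hat hGd) hG0 hp.1 hz₀ hp.2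
    have hKp : K p = K (p.1, w₀) :=
      eq_of_pw_eq_zero h₂ hc₂.isPreconnected (hat hKd) hK0 hp.1 hp.2 hw₀
    rw [hGp, hKp]
    exact (((hφ p.1 hp.1).comp_hasFDerivAt p hasFDerivAt_fst).add
      ((hψ p.2 hp.2).comp_hasFDerivAt p hasFDerivAt_snd)).neg.cexp
  have hΦd : DifferentiableOn ℂ Φ (D₁ ×ˢ D₂) := fun p hp =>
    (hΦ p hp).differentiableAt.differentiableWithinAt
  obtain ⟨H, hHd, hH⟩ := IsClosed1.exists_primitive
    (ω := (fun p => a p * Φ p, fun p => b p * Φ p)) (U := D₁ ×ˢ D₂)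
    (by
      intro p hp
      have ha1 : fderiv ℂ a p (0, 1) = pw a p := rfl
      have hb1 : fderiv ℂ b p (1, 0) = pz b p := rfl
      have hap := ha0 p hp
      have hbp := hb0 p hp
      simp only [pw, pz, fderiv_fun_mul (hat ha p hp) (hat hΦd p hp),
        fderiv_fun_mul (hat hb p hp) (hat hΦd p hp), (hΦ p hp).fderiv]
      simp [ha1, hb1, hG, hK]
      field_simp
      ring)
    ⟨ha.fun_mul hΦd, hb.fun_mul hΦd⟩ hU (hc₁.prod hc₂)
  refine ⟨fun z => Complex.exp (φ z), fun w => Complex.exp (ψ w), H,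
    fun z hz => (hφ z hz).cexp.differentiableAt.differentiableWithinAt,
    fun z _ => Complex.exp_ne_zero _,
    fun w hw => (hψ w hw).cexp.differentiableAt.differentiableWithinAt,
    fun w _ => Complex.exp_ne_zero _, hHd, fun p hp => ?_⟩
  have hone : Complex.exp (φ p.1) * Complex.exp (ψ p.2) * Φ p = 1 := by
    rw [← Complex.exp_add, ← Complex.exp_add, add_neg_cancel, Complex.exp_zero]
  rw [(hH p hp).1, (hH p hp).2]
  constructor
  · linear_combination (-a p) * hone
  · linear_combination (-b p) * hone
end
end

section
/- Let U ⊆ ℂ × ℂ be open and let ω1, ω2, ω3 be holomorphic 1-forms on U with ω1 + ω2 + ω3 = 0 and with ω1∧ω2 nonvanishing on U. For a triple (ω1,ω2,ω3), write γ(ω1,ω2,ω3) = h2·ω1 − h1·ω2 where Ω = ω1∧ω2 and h_i = dω_i/Ω. Then for every permutation σ of {1,2,3} and every ζ ∈ ℂ with ζ³ = 1, the triple (ζ·ω_{σ(1)}, ζ·ω_{σ(2)}, ζ·ω_{σ(3)}) also has nonvanishing wedge of its first two forms and satisfies γ(ζ·ω_{σ(1)}, ζ·ω_{σ(2)}, ζ·ω_{σ(3)})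 = γ(ω1, ω2, ω3) on U. -/
noncomputable section

/-- The coefficient `h = dω/Ω` where `Ω = ω1∧ω2`. -/
def hcoef (ω1 ω2 ω : Form1) : ℂ × ℂ → ℂ := fun p => dForm ω p / wedge ω1 ω2 p

/-- `γ(ω1,ω2,ω3) = h2·ω1 − h1·ω2` where `Ω = ω1∧ω2` and `h_i = dω_i/Ω`. -/
def gammaOf3 (ω1 ω2 ω3 : Form1) : Form1 :=
  subF (fsmul (hcoef ω1 ω2 ω2) ω1) (fsmul (hcoef ω1 ω2 ω1) ω2)

theorem dForm_csmul (c : ℂ) (ω : Form1) (p : ℂ × ℂ) : dForm (csmul c ω) p = c * dForm ω p := by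
  have h (f : ℂ × ℂ → ℂ) (v : ℂ × ℂ) :
      fderiv ℂ (fun q => c * f q) p v = c * fderiv ℂ f p v := by
    have := fderiv_const_smul_field (𝕜 := ℂ) (f := f) c
    simpa [Pi.smul_def, smul_eq_mul] using congrArg (fun L => L p v) this
  simp only [dForm, pz, pw, csmul, h]
  ring

theorem wedge_csmul (c : ℂ) (ω η : Form1) (p : ℂ × ℂ) :
    wedge (csmul c ω) (csmul c η) p = c ^ 2 * wedge ω η p := by
  simp only [wedge, csmul]
  ring

theorem fderiv_add_add_eq_zero {U : Set (ℂ × ℂ)} (hU : IsOpen U) {f g k : ℂ × ℂ → ℂ}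
    (hf : DifferentiableOn ℂ f U) (hg : DifferentiableOn ℂ g U) (hk : DifferentiableOn ℂ k U)
    (h : ∀ p ∈ U, f p + g p + k p = 0) {p : ℂ × ℂ} (hp : p ∈ U) (v : ℂ × ℂ) :
    fderiv ℂ f p v + fderiv ℂ g p v + fderiv ℂ k p v = 0 := by
  have hn := hU.mem_nhds hp
  have hd := ((hf.differentiableAt hn).hasFDerivAt.add (hg.differentiableAt hn).hasFDerivAt).add
    (hk.differentiableAt hn).hasFDerivAt
  have hz : f + g + k =ᶠ[nhds p] fun _ => (0 : ℂ) := Filter.eventually_of_mem hn h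
  have := (hd.congr_of_eventuallyEq hz.symm).unique (hasFDerivAt_const (0 : ℂ) p)
  simpa using congrArg (fun L => L v) this

theorem dForm_add_add_eq_zero {U : Set (ℂ × ℂ)} (hU : IsOpen U) {α β η : Form1}
    (hα : HoloForm α U) (hβ : HoloForm β U) (hη : HoloForm η U)
    (hsum : ∀ p ∈ U, α.1 p + β.1 p + η.1 p = 0 ∧ α.2 p + β.2 p + η.2 p = 0)
    {p : ℂ × ℂ} (hp : p ∈ U) : dForm α p + dForm β p + dForm η p = 0 := by
  have h₁ := fderiv_add_add_eq_zero hU hα.1 hβ.1 hη.1 (fun q hq => (hsum q hq).1) hp (0, 1)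
  have h₂ := fderiv_add_add_eq_zero hU hα.2 hβ.2 hη.2 (fun q hq => (hsum q hq).2) hp (1, 0)
  simp only [dForm, pz, pw]
  linear_combination h₂ - h₁

/-- `γ` is unchanged when the triple is multiplied by any nonzero constant. -/
theorem gammaOf3_csmul {c : ℂ} (hc : c ≠ 0) (α β η : Form1) :
    gammaOf3 (csmul c α) (csmul c β) (csmul c η) = gammaOf3 α β η := by
  have h (d w x : ℂ) : c * d / (c ^ 2 * w) * (c * x) = d / w * x := by
    rw [show c * d / (c ^ 2 * w) * (c * x) = c ^ 2 * (d * x) / (c ^ 2 * w) by ring,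
      mul_div_mul_left _ _ (pow_ne_zero 2 hc)]
    ring
  ext p <;>
  · simp only [gammaOf3, subF, fsmul, hcoef, dForm_csmul, wedge_csmul]
    simp only [csmul, h]

theorem gammaOf3_swap (α β η η' : Form1) : gammaOf3 β α η = gammaOf3 α β η' := by
  have h (p : ℂ × ℂ) : wedge β α p = -wedge α β p := by
    simp only [wedge]
    ring
  ext p <;>
  · simp only [gammaOf3, subF, fsmul, hcoef, h, div_neg]
    ring

theorem wedge_rotate {α β η : Form1} {p : ℂ × ℂ} (h₁ : α.1 p + β.1 p + η.1 p = 0)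
    (h₂ : α.2 p + β.2 p + η.2 p = 0) : wedge β η p = wedge α β p := by
  simp only [wedge]
  linear_combination β.1 p * h₂ - β.2 p * h₁

theorem gammaOf3_rotate {α β η : Form1} {p : ℂ × ℂ} (h₁ : α.1 p + β.1 p + η.1 p = 0)
    (h₂ : α.2 p + β.2 p + η.2 p = 0) (hd : dForm α p + dForm β p + dForm η p = 0) :
    (gammaOf3 β η α).1 p = (gammaOf3 α β η).1 p ∧
      (gammaOf3 β η α).2 p = (gammaOf3 α β η).2 p := by
  simp only [gammaOf3, subF, fsmul, hcoef, wedge_rotate h₁ h₂]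
  constructor
  · linear_combination (β.1 p * hd - dForm β p * h₁) / wedge α β p
  · linear_combination (β.2 p * hd - dForm β p * h₂) / wedge α β p

/-- `γ` is invariant under permuting the normalized triple and
multiplying it by a cube root of unity. -/
theorem stmt_12 (U : Set (ℂ × ℂ)) (hU : IsOpen U)
    (ω : Fin 3 → Form1) (hholo : ∀ i, HoloForm (ω i) U)
    (hsum : ∀ p ∈ U, (ω 0).1 p + (ω 1).1 p + (ω 2).1 p = 0 ∧
                     (ω 0).2 p + (ω 1).2 p + (ω 2).2 p = 0)
    (hΩ : ∀ p ∈ U, wedge (ω 0) (ω 1) p ≠ 0)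
    (σ : Equiv.Perm (Fin 3)) (ζ : ℂ) (hζ : ζ ^ 3 = 1) :
    (∀ p ∈ U, wedge (csmul ζ (ω (σ 0))) (csmul ζ (ω (σ 1))) p ≠ 0) ∧
    (∀ p ∈ U,
      (gammaOf3 (csmul ζ (ω (σ 0))) (csmul ζ (ω (σ 1))) (csmul ζ (ω (σ 2)))).1 p =
        (gammaOf3 (ω 0) (ω 1) (ω 2)).1 p ∧
      (gammaOf3 (csmul ζ (ω (σ 0))) (csmul ζ (ω (σ 1))) (csmul ζ (ω (σ 2)))).2 p =
        (gammaOf3 (ω 0) (ω 1) (ω 2)).2 p) := by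
  have hζ0 : ζ ≠ 0 := by
    rintro rfl
    norm_num at hζ
  suffices h : ∀ p ∈ U, wedge (ω (σ 0)) (ω (σ 1)) p ≠ 0 ∧
      (gammaOf3 (ω (σ 0)) (ω (σ 1)) (ω (σ 2))).1 p = (gammaOf3 (ω 0) (ω 1) (ω 2)).1 p ∧
      (gammaOf3 (ω (σ 0)) (ω (σ 1)) (ω (σ 2))).2 p = (gammaOf3 (ω 0) (ω 1) (ω 2)).2 p by
    refine ⟨fun p hp => ?_, fun p hp => ?_⟩
    · rw [wedge_csmul]
      exact mul_ne_zero (pow_ne_zero 2 hζ0) (h p hp).1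
    · rw [gammaOf3_csmul hζ0]
      exact (h p hp).2
  intro p hp
  obtain ⟨h₁, h₂⟩ := hsum p hp
  have hd := dForm_add_add_eq_zero hU (hholo 0) (hholo 1) (hholo 2) hsum hp
  have h₁' : (ω 1).1 p + (ω 2).1 p + (ω 0).1 p = 0 := by linear_combination h₁
  have h₂' : (ω 1).2 p + (ω 2).2 p + (ω 0).2 p = 0 := by linear_combination h₂
  have hd' : dForm (ω 1) p + dForm (ω 2) p + dForm (ω 0) p = 0 := by linear_combination hd
  have w01 := hΩ p hp
  have w12 : wedge (ω 1) (ω 2) p ≠ 0 := by rwa [wedge_rotate h₁ h₂]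
  have w20 : wedge (ω 2) (ω 0) p ≠ 0 := by rwa [wedge_rotate h₁' h₂']
  have g12 := gammaOf3_rotate h₁ h₂ hd
  have g20 := gammaOf3_rotate h₁' h₂' hd'
  rw [g12.1, g12.2] at g20
  have swap {α β : Form1} (h : wedge α β p ≠ 0) : wedge β α p ≠ 0 := by
    intro h0
    apply h
    simp only [wedge] at h0 ⊢
    linear_combination -h0
  have hne : σ 0 ≠ σ 1 := σ.injective.ne (by decide)
  generalize σ 0 = i, σ 1 = j, σ 2 = k at hne ⊢
  fin_cases i <;> fin_cases j
  · exact absurd rfl hne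
  · exact ⟨w01, rfl, rfl⟩
  · exact ⟨swap w20, by rw [gammaOf3_swap _ _ _ (ω 1)]; exact g20⟩
  · exact ⟨swap w01, by rw [gammaOf3_swap _ _ _ (ω 2)]; exact ⟨rfl, rfl⟩⟩
  · exact absurd rfl hne
  · exact ⟨w12, g12⟩
  · exact ⟨w20, g20⟩
  · exact ⟨swap w12, by rw [gammaOf3_swap _ _ _ (ω 0)]; exact g12⟩
  · exact absurd rfl hne
end
end
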